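/- arXiv:2301.11174 — 3 statements merged into one kernel-verified Lean document; each statement's English description precedes it below -/
import Mathlib

section
/- Let μ be a σ-finite measure on a measurable space Ω and let f, g : Ω → ℝ≥0 be measurable functions with ∫ f dμ = ∫ g dμ = 1. For every measurable function D : Ω → ℝ with 0 < D(ω) < 1 for all ω such that ω ↦ f(ω)·log(D(ω)) and ω ↦ g(ω)·log(1−D(ω)) are μ-integrable, one has ∫ f·log D dμ + ∫ g·log(1−D) dμ ≤ ∫ (f·log(f/(f+g)) + g·log(g/(f+g))) dμ, where the right-hand integrand is interpreted as 0 on the set {f+g = 0} and the right-hand integral takes values in [−∞, 0] since its integrand is nonpositive. -/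
open MeasureTheory

/-- Rescaled tangent-line bound for the logarithm. -/
theorem mul_log_le_mul_log_div_add {a s x : ℝ} (ha : 0 ≤ a) (has : a ≤ s) (hx : 0 < x) :
    a * Real.log x ≤ a * Real.log (a / s) + (s * x - a) := by
  rcases ha.eq_or_lt with rfl | ha
  · simpa using mul_nonneg has hx.le
  have hs : 0 < s := ha.trans_le has
  have hlog := Real.log_le_sub_one_of_pos (div_pos hx (div_pos ha hs))
  rw [Real.log_div hx.ne' (div_pos ha hs).ne'] at hlog
  have hmul := mul_le_mul_of_nonneg_left hlog ha.le
  have heq : a * (x / (a / s) - 1) = s * x - a := by field_simp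
  linarith

/-- Pointwise optimality of the discriminator `a / (a + b)`. -/
theorem mul_log_add_mul_log_one_sub_le {a b x : ℝ} (ha : 0 ≤ a) (hb : 0 ≤ b)
    (hx0 : 0 < x) (hx1 : x < 1) :
    a * Real.log x + b * Real.log (1 - x) ≤
      a * Real.log (a / (a + b)) + b * Real.log (b / (a + b)) := by
  have h₁ := mul_log_le_mul_log_div_add ha (le_add_of_nonneg_right hb) hx0
  have h₂ := mul_log_le_mul_log_div_add hb (le_add_of_nonneg_left ha) (sub_pos.2 hx1)
  linarith

/-- Let `μ` be a σ-finite measure and `f, g : Ω → ℝ≥0` measurable with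
`∫ f dμ = ∫ g dμ = 1`. For every measurable `D : Ω → ℝ` with `0 < D ω < 1` for all `ω`,
such that `f·log D` and `g·log (1−D)` are `μ`-integrable, we have
`∫ f·log D dμ + ∫ g·log (1−D) dμ ≤ ∫ (f·log (f/(f+g)) + g·log (g/(f+g))) dμ`,
where the right-hand side is interpreted as a `[-∞, 0]`-valued (here: `EReal`-valued)
integral of a nonpositive integrand (the integrand vanishes on `{f + g = 0}` since
there `f = 0` and `g = 0`). -/
theorem discriminator_value_le_optimal {Ω : Type*} [MeasurableSpace Ω]
    (μ : Measure Ω) [SigmaFinite μ]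
    (f g : Ω → NNReal) (hf : Measurable f) (hg : Measurable g)
    (hf1 : ∫⁻ ω, (f ω : ENNReal) ∂μ = 1) (hg1 : ∫⁻ ω, (g ω : ENNReal) ∂μ = 1)
    (D : Ω → ℝ) (hD : Measurable D) (hD0 : ∀ ω, 0 < D ω) (hD1 : ∀ ω, D ω < 1)
    (hint1 : Integrable (fun ω => (f ω : ℝ) * Real.log (D ω)) μ)
    (hint2 : Integrable (fun ω => (g ω : ℝ) * Real.log (1 - D ω)) μ) :
    ((∫ ω, (f ω : ℝ) * Real.log (D ω) ∂μ
        + ∫ ω, (g ω : ℝ) * Real.log (1 - D ω) ∂μ : ℝ) : EReal) ≤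
      -((∫⁻ ω, ENNReal.ofReal
          (-((f ω : ℝ) * Real.log ((f ω : ℝ) / ((f ω : ℝ) + (g ω : ℝ)))
            + (g ω : ℝ) * Real.log ((g ω : ℝ) / ((f ω : ℝ) + (g ω : ℝ))))) ∂μ : ENNReal) : EReal) := by
  rw [← integral_add hint1 hint2, EReal.le_neg, ← EReal.coe_neg, ← integral_neg]
  have hnonneg : ∀ ω, 0 ≤ -((f ω : ℝ) * Real.log (D ω) + (g ω : ℝ) * Real.log (1 - D ω)) := by
    intro ω
    have h₁ := mul_nonpos_of_nonneg_of_nonpos (f ω).coe_nonneg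
      (Real.log_nonpos (hD0 ω).le (hD1 ω).le)
    have h₂ := mul_nonpos_of_nonneg_of_nonpos (g ω).coe_nonneg
      (Real.log_nonpos (sub_nonneg.2 (hD1 ω).le) (sub_le_self 1 (hD0 ω).le))
    linarith
  rw [← max_eq_left (integral_nonneg hnonneg), ← EReal.coe_ennreal_ofReal,
    EReal.coe_ennreal_le_coe_ennreal_iff]
  refine le_of_le_of_eq ?_ (ofReal_integral_eq_lintegral_ofReal (hint1.add hint2).neg
    (Filter.Eventually.of_forall hnonneg)).symm
  exact lintegral_mono fun ω => ENNReal.ofReal_le_ofReal <| neg_le_neg <|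
    mul_log_add_mul_log_one_sub_le (f ω).coe_nonneg (g ω).coe_nonneg (hD0 ω) (hD1 ω)
end

section
/- Let μ be a σ-finite measure on a measurable space Ω and let f, g : Ω → ℝ≥0 be measurable with ∫ f dμ = ∫ g dμ = 1. Then ∫ (f·log(f/(f+g)) + g·log(g/(f+g))) dμ = −log 4 + KL(μ.withDensity f ‖ μ.withDensity ((f+g)/2)) + KL(μ.withDensity g ‖ μ.withDensity ((f+g)/2)), where the left-hand integrand is interpreted as 0 on {f+g = 0}, and both Kullback–Leibler terms are finite. -/
open MeasureTheory

open Classical in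
/-- The Kullback–Leibler divergence `KL(P‖Q)`: it equals `∫ log (dP/dQ) dP` if `P ≪ Q`
and the log-density is `P`-integrable, and `+∞` otherwise. -/
noncomputable def klDiv {Ω : Type*} [MeasurableSpace Ω] (P Q : Measure Ω) : EReal :=
  if P ≪ Q ∧ Integrable (fun ω => Real.log ((P.rnDeriv Q ω).toReal)) P
  then ((∫ ω, Real.log ((P.rnDeriv Q ω).toReal) ∂P : ℝ) : EReal)
  else ⊤

lemma mul_log_div_add_nonpos (a b : NNReal) :
    (a : ℝ) * Real.log ((a : ℝ) / ((a : ℝ) + (b : ℝ))) ≤ 0 :=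
  mul_nonpos_of_nonneg_of_nonpos a.2 <|
    Real.log_nonpos (by positivity) (div_le_one_of_le₀ (by simp) (by positivity))

lemma neg_mul_log_div_add_le (a b : NNReal) :
    -((a : ℝ) * Real.log ((a : ℝ) / ((a : ℝ) + (b : ℝ)))) ≤ b := by
  rcases eq_zero_or_pos a with rfl | ha
  · simp
  have ha' : (0 : ℝ) < a := ha
  have hlog := Real.log_le_sub_one_of_pos (x := ((a : ℝ) + b) / a) (by positivity)
  calc -((a : ℝ) * Real.log ((a : ℝ) / ((a : ℝ) + b)))
      = a * Real.log (((a : ℝ) + b) / a) := by rw [← mul_neg, ← Real.log_inv, inv_div]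
    _ ≤ a * (((a : ℝ) + b) / a - 1) := by gcongr
    _ = b := by field_simp; ring

lemma mul_log_toReal_div_half_add (a b : NNReal) :
    (a : ℝ) * Real.log ((a : ENNReal) / (((a : ENNReal) + b) / 2)).toReal
      = a * Real.log ((a : ℝ) / ((a : ℝ) + b)) + Real.log 2 * a := by
  rcases eq_zero_or_pos a with rfl | ha
  · simp
  have ha' : (0 : ℝ) < a := ha
  have hdiv : ((a : ENNReal) / (((a : ENNReal) + b) / 2)).toReal
      = (a : ℝ) / ((a : ℝ) + b) * 2 := by
    rw [ENNReal.toReal_div, ENNReal.toReal_div, ENNReal.toReal_add (by simp) (by simp)]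
    simp only [ENNReal.coe_toReal, ENNReal.toReal_ofNat]
    field_simp
  rw [hdiv, Real.log_mul (by positivity) (by norm_num)]
  ring

section

variable {Ω : Type*} [MeasurableSpace Ω] {μ : Measure Ω} {f g : Ω → NNReal}

lemma integrable_coe_nnreal (hf : Measurable f) (hfi : ∫⁻ ω, (f ω : ENNReal) ∂μ ≠ ⊤) :
    Integrable (fun ω => (f ω : ℝ)) μ := by
  simpa using integrable_toReal_of_lintegral_ne_top hf.coe_nnreal_ennreal.aemeasurable hfi

lemma integrable_mul_log_div_add (hf : Measurable f) (hg : Measurable g)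
    (hgi : ∫⁻ ω, (g ω : ENNReal) ∂μ ≠ ⊤) :
    Integrable (fun ω => (f ω : ℝ) * Real.log ((f ω : ℝ) / ((f ω : ℝ) + (g ω : ℝ)))) μ := by
  refine (integrable_coe_nnreal hg hgi).mono' (by fun_prop) (.of_forall fun ω => ?_)
  rw [Real.norm_of_nonpos (mul_log_div_add_nonpos _ _)]
  exact neg_mul_log_div_add_le _ _

lemma withDensity_eq_withDensity_half_add (hf : Measurable f) (hg : Measurable g) :
    μ.withDensity (fun ω => (f ω : ENNReal))
      = (μ.withDensity fun ω => ((f ω : ENNReal) + (g ω : ENNReal)) / 2).withDensity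
          fun ω => (f ω : ENNReal) / (((f ω : ENNReal) + (g ω : ENNReal)) / 2) := by
  rw [← withDensity_mul μ (by fun_prop) (by fun_prop)]
  congr 1 with ω
  rw [Pi.mul_apply, ENNReal.mul_div_cancel']
  · intro h
    simp_all
  · intro h
    simp [ENNReal.div_eq_top] at h

lemma klDiv_withDensity_half_add [SigmaFinite μ] (hf : Measurable f) (hg : Measurable g)
    (hfi : ∫⁻ ω, (f ω : ENNReal) ∂μ ≠ ⊤) (hgi : ∫⁻ ω, (g ω : ENNReal) ∂μ ≠ ⊤) :
    klDiv (μ.withDensity fun ω => (f ω : ENNReal))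
        (μ.withDensity fun ω => ((f ω : ENNReal) + (g ω : ENNReal)) / 2)
      = ((∫ ω, (f ω : ℝ) * Real.log ((f ω : ℝ) / ((f ω : ℝ) + (g ω : ℝ))) ∂μ
          + Real.log 2 * ∫ ω, (f ω : ℝ) ∂μ : ℝ) : EReal) := by
  set P := μ.withDensity fun ω => (f ω : ENNReal) with hP
  set Q := μ.withDensity fun ω => ((f ω : ENNReal) + (g ω : ENNReal)) / 2 with hQ
  have hQfin : IsFiniteMeasure Q := by
    refine isFiniteMeasure_withDensity ?_
    simp_rw [div_eq_mul_inv]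
    rw [lintegral_mul_const _ (by fun_prop), lintegral_add_left (by fun_prop)]
    exact ENNReal.mul_ne_top (ENNReal.add_ne_top.2 ⟨hfi, hgi⟩) (by simp)
  have hPQ : P = Q.withDensity _ := withDensity_eq_withDensity_half_add hf hg
  have hac : P ≪ Q := hPQ ▸ withDensity_absolutelyContinuous _ _
  have hrn : (fun ω => Real.log (P.rnDeriv Q ω).toReal) =ᵐ[P]
      fun ω => Real.log ((f ω : ENNReal) / (((f ω : ENNReal) + (g ω : ENNReal)) / 2)).toReal := by
    refine hac.ae_le ?_
    have h := Measure.rnDeriv_withDensity Q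
      (f := fun ω => (f ω : ENNReal) / (((f ω : ENNReal) + (g ω : ENNReal)) / 2)) (by fun_prop)
    rw [← hPQ] at h
    filter_upwards [h] with ω hω
    rw [hω]
  have hfI := integrable_coe_nnreal hf hfi
  have hI := integrable_mul_log_div_add hf hg hgi
  have hint : Integrable (fun ω => Real.log (P.rnDeriv Q ω).toReal) P := by
    rw [integrable_congr hrn, hP, integrable_withDensity_iff_integrable_smul hf]
    simp only [NNReal.smul_def, smul_eq_mul, mul_log_toReal_div_half_add]
    exact hI.add (hfI.const_mul _)
  rw [klDiv, if_pos ⟨hac, hint⟩, integral_congr_ae hrn, hP,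
    integral_withDensity_eq_integral_smul hf]
  simp only [NNReal.smul_def, smul_eq_mul, mul_log_toReal_div_half_add]
  rw [integral_add hI (hfI.const_mul _), integral_const_mul]

end

/-- Let `μ` be σ-finite and `f, g : Ω → ℝ≥0` measurable with `∫ f dμ = ∫ g dμ = 1`. Then
`∫ (f·log (f/(f+g)) + g·log (g/(f+g))) dμ
  = −log 4 + KL(μ.withDensity f ‖ μ.withDensity ((f+g)/2))
          + KL(μ.withDensity g ‖ μ.withDensity ((f+g)/2))`,
where the left-hand side is the `[-∞,0]`-valued (`EReal`-valued) integral of the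
nonpositive integrand (which vanishes on `{f + g = 0}` since there `f = 0` and `g = 0`),
and both KL terms are finite. -/
theorem value_eq_neg_log_four_add_js {Ω : Type*} [MeasurableSpace Ω]
    (μ : Measure Ω) [SigmaFinite μ]
    (f g : Ω → NNReal) (hf : Measurable f) (hg : Measurable g)
    (hf1 : ∫⁻ ω, (f ω : ENNReal) ∂μ = 1) (hg1 : ∫⁻ ω, (g ω : ENNReal) ∂μ = 1) :
    -((∫⁻ ω, ENNReal.ofReal
          (-((f ω : ℝ) * Real.log ((f ω : ℝ) / ((f ω : ℝ) + (g ω : ℝ)))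
            + (g ω : ℝ) * Real.log ((g ω : ℝ) / ((f ω : ℝ) + (g ω : ℝ))))) ∂μ : ENNReal) : EReal)
      = ((-Real.log 4 : ℝ) : EReal)
        + klDiv (μ.withDensity fun ω => (f ω : ENNReal))
            (μ.withDensity fun ω => ((f ω : ENNReal) + (g ω : ENNReal)) / 2)
        + klDiv (μ.withDensity fun ω => (g ω : ENNReal))
            (μ.withDensity fun ω => ((f ω : ENNReal) + (g ω : ENNReal)) / 2) ∧
    klDiv (μ.withDensity fun ω => (f ω : ENNReal))
        (μ.withDensity fun ω => ((f ω : ENNReal) + (g ω : ENNReal)) / 2) ≠ ⊤ ∧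
    klDiv (μ.withDensity fun ω => (g ω : ENNReal))
        (μ.withDensity fun ω => ((f ω : ENNReal) + (g ω : ENNReal)) / 2) ≠ ⊤ := by
  have hfi : ∫⁻ ω, (f ω : ENNReal) ∂μ ≠ ⊤ := by simp [hf1]
  have hgi : ∫⁻ ω, (g ω : ENNReal) ∂μ ≠ ⊤ := by simp [hg1]
  have integral_eq_one {h : Ω → NNReal} (hh : Measurable h)
      (hh1 : ∫⁻ ω, (h ω : ENNReal) ∂μ = 1) : ∫ ω, (h ω : ℝ) ∂μ = 1 := by
    rw [integral_eq_lintegral_of_nonneg_ae (.of_forall fun ω => (h ω).coe_nonneg)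
      hh.coe_nnreal_real.aestronglyMeasurable]
    simp [hh1]
  have hF := integrable_mul_log_div_add hf hg hgi
  have hG : Integrable
      (fun ω => (g ω : ℝ) * Real.log ((g ω : ℝ) / ((f ω : ℝ) + (g ω : ℝ)))) μ := by
    simpa only [add_comm] using integrable_mul_log_div_add hg hf hfi
  have hKf := klDiv_withDensity_half_add hf hg hfi hgi
  have hKg : klDiv (μ.withDensity fun ω => (g ω : ENNReal))
        (μ.withDensity fun ω => ((f ω : ENNReal) + (g ω : ENNReal)) / 2)
      = ((∫ ω, (g ω : ℝ) * Real.log ((g ω : ℝ) / ((f ω : ℝ) + (g ω : ℝ))) ∂μ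
          + Real.log 2 * ∫ ω, (g ω : ℝ) ∂μ : ℝ) : EReal) := by
    have h := klDiv_withDensity_half_add hg hf hgi hfi
    simp_rw [add_comm (g _ : ENNReal), add_comm (g _ : ℝ) (f _ : ℝ)] at h
    exact h
  have hnonneg (ω : Ω) : 0 ≤ -((f ω : ℝ) * Real.log ((f ω : ℝ) / ((f ω : ℝ) + (g ω : ℝ)))
      + (g ω : ℝ) * Real.log ((g ω : ℝ) / ((f ω : ℝ) + (g ω : ℝ)))) := by
    have h₁ := mul_log_div_add_nonpos (f ω) (g ω)
    have h₂ := mul_log_div_add_nonpos (g ω) (f ω)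
    rw [add_comm (g ω : ℝ)] at h₂
    linarith
  have hFG : Integrable
      (fun ω => -((f ω : ℝ) * Real.log ((f ω : ℝ) / ((f ω : ℝ) + (g ω : ℝ)))
        + (g ω : ℝ) * Real.log ((g ω : ℝ) / ((f ω : ℝ) + (g ω : ℝ))))) μ := (hF.add hG).neg
  refine ⟨?_, hKf ▸ EReal.coe_ne_top _, hKg ▸ EReal.coe_ne_top _⟩
  rw [hKf, hKg, integral_eq_one hf hf1, integral_eq_one hg hg1,
    ← ofReal_integral_eq_lintegral_ofReal hFG (.of_forall hnonneg),
    EReal.coe_ennreal_ofReal, max_eq_left (integral_nonneg hnonneg), integral_neg,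
    integral_add hF hG]
  have hlog : Real.log 4 = 2 * Real.log 2 := by
    rw [show (4 : ℝ) = 2 ^ 2 by norm_num, Real.log_pow]
    norm_num
  norm_cast
  rw [hlog]
  ring
end

section
/- Let X and Y be measurable spaces and let P, Q, R be probability measures on X × Y such that the first marginal of Q equals the first marginal of P and the second marginal of R equals the second marginal of P. Let M = (1/2)·(Q + R) and N = (1/2)·(P + M). Then KL(P‖N) + KL(M‖N) + KL(P‖Q) + KL(P‖R) ≥ 0, and this sum equals 0 if and only if P = Q = R. -/
open MeasureTheory

/-- For probability measures, `klDiv` agrees with Mathlib's `ℝ≥0∞`-valued divergence. -/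
theorem klDiv_eq_coe_informationTheory {Ω : Type*} [MeasurableSpace Ω] (P Q : Measure Ω)
    [IsProbabilityMeasure P] [IsProbabilityMeasure Q] :
    klDiv P Q = ((InformationTheory.klDiv P Q : ENNReal) : EReal) := by
  unfold klDiv
  split_ifs with h
  · have hne : InformationTheory.klDiv P Q ≠ ⊤ := InformationTheory.klDiv_ne_top h.1 h.2
    rw [← EReal.coe_toReal (x := (InformationTheory.klDiv P Q : EReal)) (by simpa using hne)
      (by simp), EReal.toReal_coe_ennreal,
      InformationTheory.toReal_klDiv_of_measure_eq h.1 (by simp)]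
    rfl
  · have htop : InformationTheory.klDiv P Q = ⊤ :=
      InformationTheory.klDiv_eq_top_iff.2 fun h₁ h₂ => h ⟨h₁, h₂⟩
    simp [htop]

/-- The midpoint of two probability measures is a probability measure. -/
theorem isProbabilityMeasure_midpoint {Ω : Type*} [MeasurableSpace Ω] (P Q : Measure Ω)
    [IsProbabilityMeasure P] [IsProbabilityMeasure Q] :
    IsProbabilityMeasure ((2⁻¹ : ENNReal) • (P + Q)) :=
  ⟨by simp [ENNReal.inv_two_add_inv_two]⟩

/-- The midpoint of a measure with itself is that measure. -/
theorem midpoint_measure_self {Ω : Type*} [MeasurableSpace Ω] (P : Measure Ω) :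
    (2⁻¹ : ENNReal) • (P + P) = P := by
  rw [← two_smul ENNReal P, smul_smul, ENNReal.inv_mul_cancel (by simp) (by simp), one_smul]

/-- Theorem 1 (equilibrium of the augmented objective). Let `P, Q, R` be probability
measures on `X × Y` such that the first marginal of `Q` equals that of `P` and the second
marginal of `R` equals that of `P`. Let `M = (1/2)·(Q + R)` and `N = (1/2)·(P + M)`.
Then `KL(P‖N) + KL(M‖N) + KL(P‖Q) + KL(P‖R) ≥ 0`, with equality if and only if
`P = Q = R`. -/
theorem augmented_objective_equilibrium {X Y : Type*} [MeasurableSpace X] [MeasurableSpace Y]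
    (P Q R : Measure (X × Y))
    [IsProbabilityMeasure P] [IsProbabilityMeasure Q] [IsProbabilityMeasure R]
    (hQ : Q.fst = P.fst) (hR : R.snd = P.snd)
    (M N : Measure (X × Y))
    (hM : M = (2⁻¹ : ENNReal) • (Q + R)) (hN : N = (2⁻¹ : ENNReal) • (P + M)) :
    (0 : EReal) ≤ klDiv P N + klDiv M N + klDiv P Q + klDiv P R ∧
    (klDiv P N + klDiv M N + klDiv P Q + klDiv P R = 0 ↔ P = Q ∧ Q = R) := by
  have hMp : IsProbabilityMeasure M := hM ▸ isProbabilityMeasure_midpoint Q R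
  have hNp : IsProbabilityMeasure N := hN ▸ isProbabilityMeasure_midpoint P M
  simp only [klDiv_eq_coe_informationTheory, ← EReal.coe_ennreal_add]
  refine ⟨EReal.coe_ennreal_nonneg _, ?_⟩
  rw [EReal.coe_ennreal_eq_zero]
  constructor
  · intro h
    simp only [add_eq_zero, InformationTheory.klDiv_eq_zero_iff] at h
    exact ⟨h.1.2, h.1.2.symm.trans h.2⟩
  · rintro ⟨rfl, rfl⟩
    rw [midpoint_measure_self] at hM
    subst hM
    rw [midpoint_measure_self] at hN
    subst hN
    simp
end
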